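/- Fix t > 0. Let X be a random vector in ℝ^d, let f : [0,∞)×ℝ^d → [0,∞) be measurable, set Λ(s,x) = ∫_0^s f(r,x) dr, and let T be a nonnegative random variable whose conditional survival given X is exp(−Λ(s,X)). Assume that for each x the map s ↦ f(s,x) is nondecreasing and continuous on a right neighbourhood [t, t+h̃] of t, that E[f(t+h,X)·1{T ≥ t}] < ∞ for all h ∈ (0,h̃), and that P(T ≥ t) > 0. Then the marginal hazard of T at t exists and equals the conditional expectation of the individual hazard given survival: lim_{h→0+} h⁻¹·P(T ∈ [t,t+h) | T ≥ t) = E[f(t,X) | T ≥ t] = E[f(t,X)·exp(−Λ(t,X))] / E[exp(−Λ(t,X))]. -/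

import Mathlib

open MeasureTheory Real Set Filter Topology

theorem mh_meas {d : ℕ} (f : ℝ → (Fin d → ℝ) → ℝ) (hf : Measurable (Function.uncurry f))
    (s : ℝ) : Measurable (fun x => ∫ r in (0:ℝ)..s, f r x) := by
  have h : StronglyMeasurable (Function.uncurry (fun (x : Fin d → ℝ) (r : ℝ) => f r x)) :=
    (hf.comp measurable_swap).stronglyMeasurable
  simp only [intervalIntegral]
  exact (h.integral_prod_right (ν := volume.restrict (Ioc 0 s))).measurable.sub
    (h.integral_prod_right (ν := volume.restrict (Ioc s 0))).measurable

theorem mh_ii (g : ℝ → ℝ) (hg : Measurable g) (hnn : ∀ s, 0 ≤ g s) (s : ℝ) (hs : 0 ≤ s) :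
    IntervalIntegrable g volume 0 s ↔ ∫⁻ r in Ioc 0 s, ENNReal.ofReal (g r) ≠ ⊤ := by
  rw [intervalIntegrable_iff_integrableOn_Ioc_of_le hs, IntegrableOn,
    ← lintegral_ofReal_ne_top_iff_integrable hg.aestronglyMeasurable (ae_of_all _ hnn)]

theorem mh_deriv (g : ℝ → ℝ) (hg : Measurable g) (t k : ℝ) (hk : 0 < k)
    (hc : ContinuousOn g (Icc t (t + k))) (hi : IntervalIntegrable g volume 0 t) :
    Tendsto (fun h : ℝ => h⁻¹ * (Real.exp (-(∫ r in (0:ℝ)..t, g r))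
      - Real.exp (-(∫ r in (0:ℝ)..(t+h), g r)))) (𝓝[>] 0)
      (𝓝 (g t * Real.exp (-(∫ r in (0:ℝ)..t, g r)))) := by
  have hcw : ContinuousWithinAt g (Ioi t) t := by
    have := hc t ⟨le_refl _, by linarith⟩
    refine (this.mono_of_mem_nhdsWithin ?_)
    exact mem_of_superset (Ioc_mem_nhdsGT (by linarith : t < t + k)) Ioc_subset_Icc_self
  have h1 : HasDerivWithinAt (fun u => ∫ r in (0:ℝ)..u, g r) (g t) (Ici t) t :=
    intervalIntegral.integral_hasDerivWithinAt_right hi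
      (hg.stronglyMeasurable.stronglyMeasurableAtFilter) hcw
  have h2 := (h1.neg.exp).neg
  have h3 := hasDerivWithinAt_iff_tendsto_slope.1 h2
  have h4 : Tendsto (fun h : ℝ => t + h) (𝓝[>] 0) (𝓝[Ici t \ {t}] t) := by
    refine tendsto_nhdsWithin_iff.2 ⟨?_, ?_⟩
    · have : Tendsto (fun h : ℝ => t + h) (𝓝 0) (𝓝 (t + 0)) := by
        apply Continuous.tendsto; fun_prop
      rw [add_zero] at this
      exact this.mono_left nhdsWithin_le_nhds
    · filter_upwards [self_mem_nhdsWithin] with h hh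
      have : 0 < h := hh
      exact ⟨by simp only [mem_Ici]; linarith, by simp; linarith⟩
  have h5 := h3.comp h4
  convert h5 using 2
  · simp [slope]; ring
  · simp; ring

theorem mh_bound (g : ℝ → ℝ) (hnn : ∀ s, 0 ≤ g s) (t k h : ℝ) (hh : 0 < h)
    (hhk : h ≤ k)
    (hm : MonotoneOn g (Icc t (t + k)))
    (hc : ContinuousOn g (Icc t (t + k))) (hi : IntervalIntegrable g volume 0 t) :
    ‖h⁻¹ * (Real.exp (-(∫ r in (0:ℝ)..t, g r))
      - Real.exp (-(∫ r in (0:ℝ)..(t+h), g r)))‖ ≤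
      g (t + k) * Real.exp (-(∫ r in (0:ℝ)..t, g r)) := by
  have hi2 : IntervalIntegrable g volume t (t + h) := by
    apply ContinuousOn.intervalIntegrable
    rw [uIcc_of_le (by linarith)]
    exact hc.mono (Icc_subset_Icc_right (by linarith))
  have e : ∫ r in (0:ℝ)..(t+h), g r = (∫ r in (0:ℝ)..t, g r) + ∫ r in t..(t+h), g r :=
    (intervalIntegral.integral_add_adjacent_intervals hi hi2).symm
  have hI0 : 0 ≤ ∫ r in t..(t+h), g r :=
    intervalIntegral.integral_nonneg (by linarith) (fun u _ => hnn u)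
  have hI1 : ∫ r in t..(t+h), g r ≤ h * g (t + k) := by
    have := intervalIntegral.integral_mono_on (by linarith : t ≤ t + h) hi2
      (intervalIntegrable_const (c := g (t + k))) (fun u hu =>
        hm ⟨hu.1, by linarith [hu.2]⟩ ⟨by linarith, le_refl _⟩ (by linarith [hu.2]))
    simpa using this
  rw [e, neg_add, Real.exp_add]
  set I := ∫ r in t..(t+h), g r
  set E := Real.exp (-(∫ r in (0:ℝ)..t, g r))
  have hE : 0 < E := Real.exp_pos _
  have h6 : Real.exp (-I) ≤ 1 := Real.exp_le_one_iff.2 (by linarith)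
  have h7 : 1 - I ≤ Real.exp (-I) := by linarith [Real.add_one_le_exp (-I)]
  have : E - E * Real.exp (-I) = E * (1 - Real.exp (-I)) := by ring
  rw [this, Real.norm_of_nonneg (by
    have : 0 ≤ 1 - Real.exp (-I) := by linarith
    positivity)]
  rw [inv_mul_le_iff₀ hh]
  calc E * (1 - Real.exp (-I)) ≤ E * (h * g (t + k)) := by gcongr; linarith
    _ = _ := by ring

/-- the marginal hazard of `T` at `t` exists and equals the conditional
expectation of the individual hazard `f(t,X)` given survival `T ≥ t`. -/
theorem marginal_hazard_eq_cond_exp_individual_hazard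
    {Ω : Type*} [MeasurableSpace Ω] (P : Measure Ω) [IsProbabilityMeasure P]
    {d : ℕ} (X : Ω → (Fin d → ℝ)) (hX : Measurable X)
    (T : Ω → ℝ) (hT : Measurable T) (hTnn : ∀ ω, 0 ≤ T ω)
    (f : ℝ → (Fin d → ℝ) → ℝ) (hf : Measurable (Function.uncurry f))
    (hfnn : ∀ s x, 0 ≤ f s x)
    (Λ : ℝ → (Fin d → ℝ) → ℝ) (hΛ : ∀ s x, Λ s x = ∫ r in (0:ℝ)..s, f r x)
    (hsurv : ∀ s : ℝ, 0 ≤ s → ∀ B : Set (Fin d → ℝ), MeasurableSet B →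
      (P {ω | s ≤ T ω ∧ X ω ∈ B}).toReal
        = ∫ ω, B.indicator (fun _ => (1:ℝ)) (X ω) * Real.exp (-(Λ s (X ω))) ∂P)
    (t : ℝ) (ht : 0 < t) (htilde : ℝ) (hhtilde : 0 < htilde)
    (hmono : ∀ x, MonotoneOn (fun s => f s x) (Icc t (t + htilde)))
    (hcont : ∀ x, ContinuousOn (fun s => f s x) (Icc t (t + htilde)))
    (hint : ∀ h : ℝ, h ∈ Ioo 0 htilde →
      ∫⁻ ω in {ω | t ≤ T ω}, ENNReal.ofReal (f (t + h) (X ω)) ∂P < ⊤)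
    (hpos : 0 < P {ω | t ≤ T ω}) :
    Tendsto
      (fun h : ℝ => h⁻¹ * ((ProbabilityTheory.cond P {ω | t ≤ T ω})
          {ω | T ω ∈ Ico t (t + h)}).toReal)
      (𝓝[>] 0)
      (𝓝 ((∫ ω in {ω | t ≤ T ω}, f t (X ω) ∂P) / (P {ω | t ≤ T ω}).toReal)) ∧
    (∫ ω in {ω | t ≤ T ω}, f t (X ω) ∂P) / (P {ω | t ≤ T ω}).toReal
      = (∫ ω, f t (X ω) * Real.exp (-(Λ t (X ω))) ∂P)
          / (∫ ω, Real.exp (-(Λ t (X ω))) ∂P) := by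
  have hΛm : ∀ s, Measurable (Λ s) := by
    intro s
    have : Λ s = fun x => ∫ r in (0:ℝ)..s, f r x := funext (hΛ s)
    rw [this]; exact mh_meas f hf s
  have hfm : ∀ s, Measurable (f s) := fun s => hf.comp measurable_prodMk_left
  have hfm2 : ∀ x, Measurable (fun s => f s x) := fun x => hf.comp measurable_prodMk_right
  have hΛnn : ∀ s, 0 ≤ s → ∀ x, 0 ≤ Λ s x := fun s hs x => by
    rw [hΛ]; exact intervalIntegral.integral_nonneg hs (fun u _ => hfnn u x)
  have hSm : ∀ s, MeasurableSet {ω | s ≤ T ω} := fun s => measurableSet_le measurable_const hT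
  have hGm : ∀ s, Measurable (fun ω => Real.exp (-(Λ s (X ω)))) := fun s =>
    Real.measurable_exp.comp ((hΛm s).comp hX).neg
  have hGi : ∀ s, 0 ≤ s → Integrable (fun ω => Real.exp (-(Λ s (X ω)))) P := fun s hs => by
    refine Integrable.of_bound (hGm s).aestronglyMeasurable 1 (ae_of_all _ fun ω => ?_)
    rw [Real.norm_of_nonneg (Real.exp_pos _).le]
    exact Real.exp_le_one_iff.2 (by linarith [hΛnn s hs (X ω)])
  -- the survival function
  have hS : ∀ s, 0 ≤ s → (P {ω | s ≤ T ω}).toReal = ∫ ω, Real.exp (-(Λ s (X ω))) ∂P := by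
    intro s hs
    simpa using hsurv s hs univ MeasurableSet.univ
  -- bad set is null
  let B : Set (Fin d → ℝ) := {x | ∫⁻ r in Ioc 0 t, ENNReal.ofReal (f r x) = ⊤}
  have hB : MeasurableSet B := by
    have h : Measurable (Function.uncurry (fun (x : Fin d → ℝ) (r : ℝ) =>
      ENNReal.ofReal (f r x))) := (hf.comp measurable_swap).ennreal_ofReal
    exact (Measurable.lintegral_prod_right (ν := volume.restrict (Ioc 0 t)) h)
      (measurableSet_singleton _)
  have hBgood : ∀ x, x ∉ B → IntervalIntegrable (fun r => f r x) volume 0 t := fun x hx =>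
    (mh_ii _ (hfm2 x) (fun s => hfnn s x) t ht.le).2 hx
  have hBbad : ∀ x ∈ B, ∀ s, t ≤ s → Λ s x = 0 := by
    intro x hx s hs
    rw [hΛ]
    apply intervalIntegral.integral_undef
    intro hI
    refine (mh_ii _ (hfm2 x) (fun s => hfnn s x) t ht.le).1 (hI.mono_set ?_) hx
    rw [uIcc_of_le ht.le, uIcc_of_le (ht.le.trans hs)]
    exact Icc_subset_Icc_right hs
  have hBnull : P (X ⁻¹' B) = 0 := by
    have h1 : ∀ n : ℕ, t ≤ n → P (X ⁻¹' B) ≤ P {ω | (n:ℝ) ≤ T ω} := by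
      intro n hn
      have h2 := hsurv n (ht.le.trans hn) B hB
      have h3 : ∫ ω, B.indicator (fun _ => (1:ℝ)) (X ω) * Real.exp (-(Λ n (X ω))) ∂P
          = ∫ ω, (X ⁻¹' B).indicator (fun _ => (1:ℝ)) ω ∂P := by
        congr 1; ext ω
        by_cases h : X ω ∈ B
        · simp [h, hBbad _ h n hn]
        · simp [h]
      rw [h3, integral_indicator_const _ (hX hB)] at h2
      simp only [smul_eq_mul, mul_one, Measure.real] at h2
      rw [ENNReal.toReal_eq_toReal_iff' (measure_ne_top _ _) (measure_ne_top _ _)] at h2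
      rw [← h2]
      exact measure_mono (fun ω h => h.1)
    have h4 : Tendsto (fun n : ℕ => P {ω | (n:ℝ) ≤ T ω}) atTop
        (𝓝 (P (⋂ n : ℕ, {ω | (n:ℝ) ≤ T ω}))) := by
      refine tendsto_measure_iInter_atTop (fun n => (hSm n).nullMeasurableSet) ?_
        ⟨0, measure_ne_top _ _⟩
      intro m n hmn ω h
      have : (m:ℝ) ≤ n := by exact_mod_cast hmn
      exact this.trans h
    have h5 : (⋂ n : ℕ, {ω | (n:ℝ) ≤ T ω}) = ∅ := by
      ext ω
      simp only [mem_iInter, mem_ofPred_eq, mem_empty_iff_false, iff_false, not_forall, not_le]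
      exact exists_nat_gt (T ω)
    rw [h5, measure_empty] at h4
    refine le_antisymm (ge_of_tendsto h4 ?_) bot_le
    obtain ⟨N, hN⟩ := exists_nat_ge t
    filter_upwards [eventually_ge_atTop N] with n hn
    exact h1 n (hN.trans (by exact_mod_cast hn))
  have hgood : ∀ᵐ ω ∂P, IntervalIntegrable (fun r => f r (X ω)) volume 0 t := by
    have : ∀ᵐ ω ∂P, ω ∉ X ⁻¹' B := measure_eq_zero_iff_ae_notMem.1 hBnull
    filter_upwards [this] with ω h using hBgood _ h
  -- change of measure
  let S : Set Ω := {ω | t ≤ T ω}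
  have hmeas : (P.restrict S).map X
      = (P.withDensity (fun ω => ENNReal.ofReal (Real.exp (-(Λ t (X ω)))))).map X := by
    ext A hA
    rw [Measure.map_apply hX hA, Measure.map_apply hX hA, Measure.restrict_apply (hX hA),
      withDensity_apply _ (hX hA), ← ofReal_integral_eq_lintegral_ofReal
        (hGi t ht.le).integrableOn (ae_of_all _ fun _ => (Real.exp_pos _).le),
      ← integral_indicator (hX hA)]
    have h1 := hsurv t ht.le A hA
    have h2 : (X ⁻¹' A) ∩ S = {ω | t ≤ T ω ∧ X ω ∈ A} := by
      ext ω; simp [S, and_comm]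
    rw [h2, ← ENNReal.ofReal_toReal (measure_ne_top P _), h1]
    congr 2; ext ω
    by_cases h : X ω ∈ A <;> simp [h]
  have hlint : ∀ g : (Fin d → ℝ) → ENNReal, Measurable g →
      ∫⁻ ω in S, g (X ω) ∂P = ∫⁻ ω, ENNReal.ofReal (Real.exp (-(Λ t (X ω)))) * g (X ω) ∂P := by
    intro g hg
    rw [← lintegral_map (μ := P.restrict S) hg hX, hmeas, lintegral_map hg hX]
    exact lintegral_withDensity_eq_lintegral_mul _ (hGm t).ennreal_ofReal (hg.comp hX)
  have hlint2 : ∀ s, ∫⁻ ω in S, ENNReal.ofReal (f s (X ω)) ∂P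
      = ∫⁻ ω, ENNReal.ofReal (f s (X ω) * Real.exp (-(Λ t (X ω)))) ∂P := by
    intro s
    rw [hlint (fun x => ENNReal.ofReal (f s x)) (hfm s).ennreal_ofReal]
    congr 1; ext ω
    rw [ENNReal.ofReal_mul (hfnn _ _), mul_comm]
  have hfGm : ∀ s, Measurable (fun ω => f s (X ω) * Real.exp (-(Λ t (X ω)))) := fun s =>
    ((hfm s).comp hX).mul (hGm t)
  have hfGnn : ∀ s ω, 0 ≤ f s (X ω) * Real.exp (-(Λ t (X ω))) := fun s ω =>
    mul_nonneg (hfnn _ _) (Real.exp_pos _).le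
  have hnum : ∫ ω in S, f t (X ω) ∂P = ∫ ω, f t (X ω) * Real.exp (-(Λ t (X ω))) ∂P := by
    rw [integral_eq_lintegral_of_nonneg_ae (ae_of_all _ fun ω => hfnn _ _)
      ((hfm t).comp hX).aestronglyMeasurable,
      integral_eq_lintegral_of_nonneg_ae (ae_of_all _ fun ω => hfGnn _ _)
      (hfGm t).aestronglyMeasurable, hlint2]
  refine ⟨?_, by rw [hS t ht.le]; congr 1⟩
  change Tendsto _ _ (𝓝 ((∫ ω in S, f t (X ω) ∂P) / _))
  rw [hnum]
  let k := htilde / 2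
  have hk : 0 < k := by positivity
  have hkt : k < htilde := half_lt_self hhtilde
  have hbi : Integrable (fun ω => f (t + k) (X ω) * Real.exp (-(Λ t (X ω)))) P := by
    rw [← lintegral_ofReal_ne_top_iff_integrable (hfGm _).aestronglyMeasurable
      (ae_of_all _ (hfGnn _)), ← hlint2]
    exact (hint k ⟨hk, hkt⟩).ne
  have hsub : Icc t (t + k) ⊆ Icc t (t + htilde) := Icc_subset_Icc_right (by linarith)
  have hlim : Tendsto (fun h : ℝ => ∫ ω, h⁻¹ * (Real.exp (-(Λ t (X ω)))
      - Real.exp (-(Λ (t + h) (X ω)))) ∂P) (𝓝[>] 0)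
      (𝓝 (∫ ω, f t (X ω) * Real.exp (-(Λ t (X ω))) ∂P)) := by
    refine tendsto_integral_filter_of_dominated_convergence _ ?_ ?_ hbi ?_
    · exact Eventually.of_forall fun h =>
        (((hGm t).sub (hGm (t + h))).const_mul _).aestronglyMeasurable
    · filter_upwards [Ioc_mem_nhdsGT hk] with h hh
      filter_upwards [hgood] with ω hω
      rw [hΛ, hΛ]
      exact mh_bound (fun r => f r (X ω)) (fun s => hfnn s _) t k h hh.1 hh.2
        ((hmono _).mono hsub) ((hcont _).mono hsub) hω
    · filter_upwards [hgood] with ω hω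
      simp only [hΛ]
      exact mh_deriv (fun r => f r (X ω)) (hfm2 _) t k hk ((hcont _).mono hsub) hω
  refine (hlim.div_const (P {ω | t ≤ T ω}).toReal).congr' ?_
  filter_upwards [self_mem_nhdsWithin] with h hh
  have hh : 0 < h := hh
  have hset : S ∩ {ω | T ω ∈ Ico t (t + h)} = {ω | t ≤ T ω} \ {ω | t + h ≤ T ω} := by
    ext ω; simp [S]
  rw [integral_const_mul, integral_sub (hGi t ht.le) (hGi (t + h) (by linarith)),
    ProbabilityTheory.cond_apply (hSm t)]
  change _ = h⁻¹ * ((P S)⁻¹ * P (S ∩ {ω | T ω ∈ Ico t (t + h)})).toReal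
  have hsub2 : {ω | t + h ≤ T ω} ⊆ {ω | t ≤ T ω} := fun ω hω => by
    have : t + h ≤ T ω := hω
    simp only [mem_ofPred_eq]; linarith
  rw [hset, ENNReal.toReal_mul, measure_sdiff hsub2 (hSm _).nullMeasurableSet (measure_ne_top _ _),
    ENNReal.toReal_sub_of_le (measure_mono hsub2) (measure_ne_top _ _), hS t ht.le,
    hS (t + h) (by linarith), ENNReal.toReal_inv, hS t ht.le]
  ring
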